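/- Let n ≥ 1, let R be a finite-index normal subgroup of the free group F_n, let G = F_n/R be the (finite) quotient group, and let k be a field of characteristic 0. Equip H₁(R;k) := Abelianization(R) ⊗_ℤ k with the k[G]-module structure induced by the conjugation action of F_n on R (this action descends to G because inner automorphisms by elements of R act trivially on Abelianization(R)). Then H₁(R;k) is isomorphic as a k[G]-module to k ⊕ (k[G])^{n−1}, where k carries the trivial G-action and k[G] is the regular representation. -/

import Mathlib

open scoped TensorProduct

noncomputable section

variable {π : Type} [Group π]

/-- Conjugation action of π on the abelianization of a normal subgroup R. -/
def conjAbAut (R : Subgroup π) [R.Normal] : π →* MulAut (Abelianization ↥R) where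
  toFun p := MulEquiv.abelianizationCongr (MulAut.conjNormal p)
  map_one' := by simp [MulAut.one_def]
  map_mul' := fun p q => by simp [MulAut.mul_def]

/-- The conjugation action descends to the quotient π ⧸ R, since inner automorphisms by
elements of R act trivially on the abelianization of R. -/
def conjQuotAut (R : Subgroup π) [R.Normal] : π ⧸ R →* MulAut (Abelianization ↥R) :=
  QuotientGroup.lift R (conjAbAut R) (by
    intro r hr
    ext x
    refine QuotientGroup.induction_on x ?_
    intro y
    show (MulEquiv.abelianizationCongr (MulAut.conjNormal r)) (Abelianization.of y)
        = Abelianization.of y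
    rw [abelianizationCongr_of]
    have : (MulAut.conjNormal r) y = (⟨r, hr⟩ : ↥R) * y * (⟨r, hr⟩ : ↥R)⁻¹ := by
      ext; simp
    rw [this, map_mul, map_mul, map_inv, mul_comm, inv_mul_cancel_left])

/-- A multiplicative automorphism of a commutative group as a ℤ-linear endomorphism of the
additivization. -/
def mulAutToEnd {A : Type} [CommGroup A] (e : MulAut A) :
    Additive A →ₗ[ℤ] Additive A :=
  AddMonoidHom.toIntLinearMap
    { toFun := fun x => Additive.ofMul (e x.toMul)
      map_zero' := by simp
      map_add' := fun a b => by simp }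

lemma mulAutToEnd_one {A : Type} [CommGroup A] :
    mulAutToEnd (1 : MulAut A) = LinearMap.id := by
  ext x; rfl

lemma mulAutToEnd_mul {A : Type} [CommGroup A] (e f : MulAut A) :
    mulAutToEnd (e * f) = (mulAutToEnd e).comp (mulAutToEnd f) := by
  ext x; rfl

/-- The k[G]-module structure (as a representation of G = π ⧸ R over k) on
H₁(R;k) = k ⊗ Abelianization R, induced by the conjugation action of π on R. -/
def conjRep (R : Subgroup π) [R.Normal] (k : Type) [CommRing k] :
    Representation k (π ⧸ R) (k ⊗[ℤ] Additive (Abelianization ↥R)) where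
  toFun g := LinearMap.baseChange k (mulAutToEnd (conjQuotAut R g))
  map_one' := by
    show LinearMap.baseChange k (mulAutToEnd ((conjQuotAut R) 1)) = 1
    rw [map_one, mulAutToEnd_one]
    exact LinearMap.baseChange_id
  map_mul' := fun g h => by
    show LinearMap.baseChange k (mulAutToEnd ((conjQuotAut R) (g * h)))
        = LinearMap.baseChange k (mulAutToEnd ((conjQuotAut R) g))
          * LinearMap.baseChange k (mulAutToEnd ((conjQuotAut R) h))
    rw [map_mul, mulAutToEnd_mul, LinearMap.baseChange_comp]
    rfl

theorem split_surj {A M N : Type} [Ring A] [AddCommGroup M] [AddCommGroup N] [Module A M] [Module A N]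
    [IsSemisimpleModule A M] (f : M →ₗ[A] N) (hf : Function.Surjective f) :
    Nonempty (M ≃ₗ[A] LinearMap.ker f × N) := by
  obtain ⟨q, hq⟩ := exists_isCompl (LinearMap.ker f)
  exact ⟨(Submodule.prodEquivOfIsCompl _ q hq).symm.trans
    ((LinearEquiv.refl A _).prodCongr ((Submodule.quotientEquivOfIsCompl _ q hq).symm.trans
      (f.quotKerEquivOfSurjective hf)))⟩

theorem ker_equiv_of_simple {A M S : Type} [Ring A] [AddCommGroup M] [AddCommGroup S] [Module A M]
    [Module A S] [IsSemisimpleModule A M] [IsSimpleModule A S] (f g : M →ₗ[A] S)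
    (hf : Function.Surjective f) (hg : Function.Surjective g) :
    Nonempty (LinearMap.ker f ≃ₗ[A] LinearMap.ker g) := by
  by_cases h : LinearMap.ker f = LinearMap.ker g
  · exact ⟨LinearEquiv.ofEq _ _ h⟩
  have cf : IsCoatom (LinearMap.ker f) := LinearMap.isCoatom_ker_of_surjective hf
  have cg : IsCoatom (LinearMap.ker g) := LinearMap.isCoatom_ker_of_surjective hg
  have key : ∀ f g : M →ₗ[A] S, IsCoatom (LinearMap.ker f) → IsCoatom (LinearMap.ker g) →
      LinearMap.ker f ≠ LinearMap.ker g →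
      Nonempty (LinearMap.ker f ≃ₗ[A]
        LinearMap.ker (g ∘ₗ (LinearMap.ker f).subtype) × S) := by
    intro f g cf cg h
    apply split_surj
    apply (LinearMap.surjective_or_eq_zero _).resolve_right
    intro h0
    have hle : LinearMap.ker f ≤ LinearMap.ker g := by
      intro x hx
      exact LinearMap.congr_fun h0 ⟨x, hx⟩
    exact h ((cf.le_iff_eq cg.1).1 hle).symm
  obtain ⟨e1⟩ := key f g cf cg h
  obtain ⟨e2⟩ := key g f cg cf (Ne.symm h)
  let e3 : LinearMap.ker (g ∘ₗ (LinearMap.ker f).subtype) ≃ₗ[A]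
      LinearMap.ker (f ∘ₗ (LinearMap.ker g).subtype) :=
    { toFun := fun x => ⟨⟨x.1.1, x.2⟩, x.1.2⟩
      invFun := fun x => ⟨⟨x.1.1, x.2⟩, x.1.2⟩
      map_add' := fun _ _ => rfl
      map_smul' := fun _ _ => rfl
      left_inv := fun _ => rfl
      right_inv := fun _ => rfl }
  exact ⟨e1.trans ((e3.prodCongr (LinearEquiv.refl A S)).trans e2.symm)⟩

def kerFstEquiv (A S B : Type) [Ring A] [AddCommGroup S] [Module A S]
    [AddCommGroup B] [Module A B] : LinearMap.ker (LinearMap.fst A S B) ≃ₗ[A] B :=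
  { toFun := fun x => x.1.2
    invFun := fun b => ⟨(0, b), rfl⟩
    map_add' := fun _ _ => rfl
    map_smul' := fun _ _ => rfl
    left_inv := fun x => by
      obtain ⟨⟨s, b⟩, h⟩ := x
      have : s = 0 := h
      subst this; rfl
    right_inv := fun _ => rfl }

theorem cancel_simple {A S B C : Type} [Ring A] [IsSemisimpleRing A] [AddCommGroup S] [Module A S]
    [AddCommGroup B] [Module A B] [AddCommGroup C] [Module A C] [IsSimpleModule A S]
    (e : (S × B) ≃ₗ[A] (S × C)) : Nonempty (B ≃ₗ[A] C) := by
  obtain ⟨e1⟩ := ker_equiv_of_simple (LinearMap.fst A S B) (LinearMap.fst A S C ∘ₗ e.toLinearMap)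
    Prod.fst_surjective (Prod.fst_surjective.comp e.surjective)
  have e2 : LinearMap.ker (LinearMap.fst A S C ∘ₗ e.toLinearMap) ≃ₗ[A]
      LinearMap.ker (LinearMap.fst A S C) :=
    e.ofSubmodules _ _ (by
      rw [LinearMap.ker_comp]
      exact Submodule.map_comap_eq_of_surjective e.surjective _)
  exact ⟨(kerFstEquiv A S B).symm.trans (e1.trans (e2.trans (kerFstEquiv A S C)))⟩

theorem cancel_pi {A : Type} [Ring A] [IsSemisimpleRing A] (m : ℕ) :
    ∀ (S : Fin m → Type) [∀ i, AddCommGroup (S i)] [∀ i, Module A (S i)]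
    [∀ i, IsSimpleModule A (S i)] (B C : Type)
    [AddCommGroup B] [Module A B] [AddCommGroup C] [Module A C]
    (_ : ((∀ i, S i) × B) ≃ₗ[A] ((∀ i, S i) × C)), Nonempty (B ≃ₗ[A] C) := by
  induction m with
  | zero =>
    intro S _ _ _ B C _ _ _ _ e
    exact ⟨(LinearEquiv.uniqueProd (R := A) (M := B) (M₂ := ∀ i, S i)).symm.trans
      (e.trans LinearEquiv.uniqueProd)⟩
  | succ m ih =>
    intro S _ _ _ B C _ _ _ _ e
    have c := fun (X : Type) [AddCommGroup X] [Module A X] =>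
      (((Fin.consLinearEquiv A S).symm.prodCongr (LinearEquiv.refl A X)).trans
        (LinearEquiv.prodAssoc A (S 0) (∀ i : Fin m, S i.succ) X))
    obtain ⟨e'⟩ := cancel_simple ((c B).symm.trans (e.trans (c C)))
    exact ih (fun i => S i.succ) B C e'

theorem cancel_self {A : Type} [Ring A] [IsSemisimpleRing A] (B C : Type)
    [AddCommGroup B] [Module A B] [AddCommGroup C] [Module A C]
    (e : (A × B) ≃ₗ[A] (A × C)) : Nonempty (B ≃ₗ[A] C) := by
  obtain ⟨m, S, f, hS⟩ := IsSemisimpleModule.exists_linearEquiv_fin_dfinsupp A A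
  have f' : A ≃ₗ[A] (∀ i, S i) := f.trans DFinsupp.linearEquivFunOnFintype
  exact cancel_pi m (fun i => S i) B C
    ((f'.symm.prodCongr (LinearEquiv.refl A B)).trans
      (e.trans (f'.prodCongr (LinearEquiv.refl A C))))

section
variable {n : ℕ} {R : Subgroup (FreeGroup (Fin n))} [R.Normal] {k : Type} [Field k]

/-- The group algebra of the quotient. -/
abbrev GA (R : Subgroup (FreeGroup (Fin n))) [R.Normal] (k : Type) [Field k] :=
  MonoidAlgebra k (FreeGroup (Fin n) ⧸ R)

/-- The image of a free group element in the group algebra. -/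
def gel (R : Subgroup (FreeGroup (Fin n))) [R.Normal] (k : Type) [Field k]
    (a : FreeGroup (Fin n)) : GA R k := MonoidAlgebra.of k _ (a : FreeGroup (Fin n) ⧸ R)

lemma gel_mul (a b : FreeGroup (Fin n)) : gel R k (a * b) = gel R k a * gel R k b := by
  simp [gel, MonoidAlgebra.single_mul_single]

lemma gel_one : gel R k (1 : FreeGroup (Fin n)) = 1 := by
  simp [gel, MonoidAlgebra.one_def]

lemma gel_mem {a : FreeGroup (Fin n)} (h : a ∈ R) : gel R k a = 1 := by
  rw [← gel_one, gel, gel, (QuotientGroup.eq_one_iff a).2 h]; rfl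

variable {M : Type} [AddCommGroup M] [Module (GA R k) M]

/-- Crossed homomorphisms. -/
def IsDer (R : Subgroup (FreeGroup (Fin n))) [R.Normal] (k : Type) [Field k]
    {M : Type} [AddCommGroup M] [Module (GA R k) M] (d : FreeGroup (Fin n) → M) : Prop :=
  ∀ a b, d (a * b) = d a + gel R k a • d b

lemma IsDer.one {d : FreeGroup (Fin n) → M} (h : IsDer R k d) : d 1 = 0 := by
  have := h 1 1
  rw [gel_one, one_smul, mul_one] at this
  simpa using this

lemma IsDer.inv {d : FreeGroup (Fin n) → M} (h : IsDer R k d) (a : FreeGroup (Fin n)) :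
    d a⁻¹ = - (gel R k a⁻¹ • d a) := by
  have := h a⁻¹ a
  rw [inv_mul_cancel, h.one] at this
  exact eq_neg_of_add_eq_zero_left this.symm

lemma IsDer.ext {d d' : FreeGroup (Fin n) → M} (h : IsDer R k d) (h' : IsDer R k d')
    (H : ∀ i, d (FreeGroup.of i) = d' (FreeGroup.of i)) (a : FreeGroup (Fin n)) : d a = d' a := by
  induction a using FreeGroup.induction_on with
  | C1 => rw [h.one, h'.one]
  | of i => exact H i
  | inv_of i hi => rw [h.inv, h'.inv]; exact congrArg _ (congrArg _ hi)
  | mul a b ha hb => rw [h, h', ha, hb]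

/-- An affine permutation. -/
def affPerm (R : Subgroup (FreeGroup (Fin n))) [R.Normal] (k : Type) [Field k]
    {M : Type} [AddCommGroup M] [Module (GA R k) M] (v : M) (a : FreeGroup (Fin n)) :
    Equiv.Perm M where
  toFun m := v + gel R k a • m
  invFun m := gel R k a⁻¹ • (m - v)
  left_inv m := by simp [smul_smul, ← gel_mul, gel_one]
  right_inv m := by simp [smul_smul, ← gel_mul, gel_one]

/-- The Fox derivative with prescribed values on generators. -/
def fox (R : Subgroup (FreeGroup (Fin n))) [R.Normal] (k : Type) [Field k]
    {M : Type} [AddCommGroup M] [Module (GA R k) M] (v : Fin n → M) (a : FreeGroup (Fin n)) : M :=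
  FreeGroup.lift (fun i => affPerm R k (v i) (FreeGroup.of i)) a 0

lemma fox_of (v : Fin n → M) (i : Fin n) : fox R k v (FreeGroup.of i) = v i := by
  simp [fox, affPerm]

lemma fox_aux (v : Fin n → M) (a : FreeGroup (Fin n)) :
    ∃ w : M, FreeGroup.lift (fun i => affPerm R k (v i) (FreeGroup.of i)) a = affPerm R k w a := by
  induction a using FreeGroup.induction_on with
  | C1 =>
    refine ⟨0, ?_⟩
    ext m; simp [affPerm, gel_one]
  | of i => exact ⟨v i, by simp⟩
  | inv_of i hi =>
    refine ⟨- (gel R k (FreeGroup.of i)⁻¹ • v i), ?_⟩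
    rw [map_inv, FreeGroup.lift_apply_of, inv_eq_iff_mul_eq_one]
    ext m
    simp [affPerm, smul_smul, ← gel_mul, gel_one]
  | mul a b ha hb =>
    obtain ⟨w, hw⟩ := ha
    obtain ⟨w', hw'⟩ := hb
    refine ⟨w + gel R k a • w', ?_⟩
    rw [map_mul, hw, hw']
    ext m
    simp [affPerm, smul_smul, gel_mul, add_assoc]

lemma fox_isDer (v : Fin n → M) : IsDer R k (fox R k v) := by
  intro a b
  obtain ⟨w, hw⟩ := fox_aux (R := R) (k := k) v a
  rw [fox, map_mul, Equiv.Perm.mul_apply, fox, fox, hw]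
  simp [affPerm]

/-! The class map from `R` to its homology module. -/

/-- The homology class of an element of `R`. -/
def cls (R : Subgroup (FreeGroup (Fin n))) [R.Normal] (k : Type) [Field k] (r : R) :
    (conjRep R k).asModule :=
  (conjRep R k).asModuleEquiv.symm (1 ⊗ₜ Additive.ofMul (Abelianization.of r))

lemma cls_mul (r s : R) : cls R k (r * s) = cls R k r + cls R k s := by
  simp only [cls, ← map_add, ← TensorProduct.tmul_add]
  simp

lemma cls_conj (a : FreeGroup (Fin n)) (r : R) :
    cls R k (MulAut.conjNormal a r) = gel R k a • cls R k r := by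
  rw [cls, cls, gel, ← Representation.asModuleEquiv_symm_map_rho]
  rfl

/-- Lift of an equivariant homomorphism from `R`. -/
def homLift [Module k M] [IsScalarTower k (GA R k) M] (φ : R → M)
    (hmul : ∀ r s, φ (r * s) = φ r + φ s)
    (hconj : ∀ a r, φ (MulAut.conjNormal a r) = gel R k a • φ r) :
    (conjRep R k).asModule →ₗ[GA R k] M :=
  let f : R →* Multiplicative M := MonoidHom.mk' (fun r => Multiplicative.ofAdd (φ r))
    (fun r s => by rw [hmul]; rfl)
  let g : Additive (Abelianization R) →ₗ[ℤ] M :=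
    (AddMonoidHom.toIntLinearMap (MonoidHom.toAdditiveLeft (Abelianization.lift f)))
  let h : k ⊗[ℤ] Additive (Abelianization R) →ₗ[k] M := LinearMap.liftBaseChange k g
  MonoidAlgebra.equivariantOfLinearOfComm (h ∘ₗ (conjRep R k).asModuleEquiv.toLinearMap) (by
    intro q v
    obtain ⟨a, rfl⟩ := QuotientGroup.mk_surjective q
    obtain ⟨v, rfl⟩ := (conjRep R k).asModuleEquiv.symm.surjective v
    induction v with
    | zero => simp
    | add x y hx hy => simp only [map_add, smul_add, hx, hy]
    | tmul c x =>
      obtain ⟨x, rfl⟩ := Additive.ofMul.surjective x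
      obtain ⟨r, rfl⟩ := QuotientGroup.mk_surjective x
      have h1 := (conjRep R k).asModuleEquiv_symm_map_rho (a : FreeGroup (Fin n) ⧸ R)
        (c ⊗ₜ Additive.ofMul (Abelianization.of r))
      rw [MonoidAlgebra.of_apply] at h1
      erw [← h1]
      have h2 : (conjRep R k) (a : FreeGroup (Fin n) ⧸ R)
        (c ⊗ₜ[ℤ] Additive.ofMul (Abelianization.of r)) =
          c ⊗ₜ[ℤ] Additive.ofMul (Abelianization.of (MulAut.conjNormal a r)) := rfl
      rw [h2]
      have h3 : ∀ s : R, h (c ⊗ₜ[ℤ] Additive.ofMul (Abelianization.of s)) = c • φ s := by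
        intro s
        simp only [h, LinearMap.liftBaseChange_tmul]
        rfl
      simp only [LinearMap.comp_apply, LinearEquiv.coe_coe, LinearEquiv.apply_symm_apply]
      rw [h3]
      erw [h3]
      rw [hconj, smul_comm]
      rfl)

lemma homLift_cls [Module k M] [IsScalarTower k (GA R k) M] (φ : R → M)
    (hmul : ∀ r s, φ (r * s) = φ r + φ s)
    (hconj : ∀ a r, φ (MulAut.conjNormal a r) = gel R k a • φ r) (r : R) :
    homLift φ hmul hconj (cls R k r) = φ r := by
  simp only [homLift, cls, MonoidAlgebra.equivariantOfLinearOfComm_apply, LinearMap.comp_apply,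
    LinearEquiv.coe_coe, LinearEquiv.apply_symm_apply, LinearMap.liftBaseChange_tmul, one_smul]
  rfl

lemma hom_ext_cls {f g : (conjRep R k).asModule →ₗ[GA R k] M} (h : ∀ r, f (cls R k r) = g (cls R k r))
    : f = g := by
  ext v
  obtain ⟨v, rfl⟩ := (conjRep R k).asModuleEquiv.symm.surjective v
  induction v with
  | zero => simp
  | add x y hx hy => simp only [map_add, hx, hy]
  | tmul c x =>
    obtain ⟨x, rfl⟩ := Additive.ofMul.surjective x
    obtain ⟨r, rfl⟩ := QuotientGroup.mk_surjective x
    have h1 : (c ⊗ₜ[ℤ] Additive.ofMul (Abelianization.of r) : k ⊗[ℤ] Additive (Abelianization R))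
      = c • ((1 : k) ⊗ₜ[ℤ] Additive.ofMul (Abelianization.of r)) := by
      rw [TensorProduct.smul_tmul', smul_eq_mul, mul_one]
    have h2 := (conjRep R k).asModuleEquiv_symm_map_smul c
      ((1 : k) ⊗ₜ[ℤ] Additive.ofMul (Abelianization.of r))
    rw [← h1] at h2
    erw [h2]
    rw [map_smul, map_smul]
    exact congrArg _ (h r)

/-! The averaged derivation. -/

/-- A section of the quotient map. -/
def sec (R : Subgroup (FreeGroup (Fin n))) [R.Normal] (q : FreeGroup (Fin n) ⧸ R) :
    FreeGroup (Fin n) := q.out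

lemma sec_mk (q : FreeGroup (Fin n) ⧸ R) : (sec R q : FreeGroup (Fin n) ⧸ R) = q :=
  QuotientGroup.out_eq' q

/-- The Schreier element `a s(q) s(aq)⁻¹`. -/
def sch (R : Subgroup (FreeGroup (Fin n))) [R.Normal] (a : FreeGroup (Fin n))
    (q : FreeGroup (Fin n) ⧸ R) : R :=
  ⟨a * sec R q * (sec R ((a : FreeGroup (Fin n) ⧸ R) * q))⁻¹, by
    rw [← QuotientGroup.eq_one_iff]
    simp [sec_mk]⟩

lemma sch_mul (a b : FreeGroup (Fin n)) (q : FreeGroup (Fin n) ⧸ R) :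
    sch R (a * b) q = MulAut.conjNormal a (sch R b q) * sch R a (b * q) := by
  ext
  simp [sch, mul_assoc]

lemma sch_mem (r : R) (q : FreeGroup (Fin n) ⧸ R) : sch R r q = r := by
  ext
  simp [sch, (QuotientGroup.eq_one_iff (r : FreeGroup (Fin n))).2 r.2]

/-- The averaged derivation. -/
def avg (R : Subgroup (FreeGroup (Fin n))) [R.Normal] (k : Type) [Field k]
    [Fintype (FreeGroup (Fin n) ⧸ R)] (a : FreeGroup (Fin n)) : (conjRep R k).asModule :=
  algebraMap k (GA R k) ((Fintype.card (FreeGroup (Fin n) ⧸ R) : k)⁻¹) • ∑ q, cls R k (sch R a q)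

lemma avg_isDer [Fintype (FreeGroup (Fin n) ⧸ R)] : IsDer R k (avg R k) := by
  intro a b
  simp only [avg, sch_mul, cls_mul, cls_conj, Finset.sum_add_distrib, smul_add, ← Finset.smul_sum]
  rw [add_comm]
  congr 1
  · congr 1
    exact Equiv.sum_comp (Equiv.mulLeft (b : FreeGroup (Fin n) ⧸ R)) (fun q => cls R k (sch R a q))
  · rw [smul_smul, smul_smul, Algebra.commutes]

lemma avg_mem [CharZero k] [Fintype (FreeGroup (Fin n) ⧸ R)] (r : R) :
    avg R k r = cls R k r := by
  simp only [avg, sch_mem, Finset.sum_const, Finset.card_univ]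
  rw [← Nat.cast_smul_eq_nsmul (GA R k), smul_smul, ← map_natCast (algebraMap k (GA R k)), ← map_mul,
    inv_mul_cancel₀ (Nat.cast_ne_zero.2 Fintype.card_ne_zero), map_one, one_smul]

/-! The relation sequence. -/

/-- The universal derivation. -/
def uD (R : Subgroup (FreeGroup (Fin n))) [R.Normal] (k : Type) [Field k] :
    FreeGroup (Fin n) → (Fin n → GA R k) :=
  fox R k (fun i => Pi.single i 1)

lemma uD_der : IsDer R k (uD R k) := fox_isDer _

/-- Linear map with prescribed values on the basis. -/
def fromFree (v : Fin n → M) : (Fin n → GA R k) →ₗ[GA R k] M :=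
  (Pi.basisFun (GA R k) (Fin n)).constr ℕ v

lemma fromFree_single (v : Fin n → M) (i : Fin n) :
    fromFree (R := R) (k := k) v (Pi.single i 1) = v i := by
  have := (Pi.basisFun (GA R k) (Fin n)).constr_basis ℕ v i
  rwa [Pi.basisFun_apply] at this

lemma fromFree_uD {d : FreeGroup (Fin n) → M} (hd : IsDer R k d) (a : FreeGroup (Fin n)) :
    fromFree (R := R) (k := k) (fun i => d (FreeGroup.of i)) (uD R k a) = d a := by
  refine IsDer.ext (R := R) (k := k) (d := fun a => fromFree (fun i => d (FreeGroup.of i)) (uD R k a))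
    ?_ hd ?_ a
  · intro a b
    simp only [uD_der a b, map_add, map_smul]
  · intro i
    simp only [uD, fox_of, fromFree_single]

lemma uD_conj (a : FreeGroup (Fin n)) (r : R) :
    uD R k (MulAut.conjNormal a r : R) = gel R k a • uD R k r := by
  have h := uD_der (R := R) (k := k)
  have h1 : ((MulAut.conjNormal a r : R) : FreeGroup (Fin n)) * a = a * r := by simp
  have h2 := congrArg (uD R k) h1
  rw [h, h, gel_mem (MulAut.conjNormal a r : R).2, one_smul, add_comm] at h2
  exact add_left_cancel h2

/-- The relation module embedding. -/
def iotaR (R : Subgroup (FreeGroup (Fin n))) [R.Normal] (k : Type) [Field k] :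
    (conjRep R k).asModule →ₗ[GA R k] (Fin n → GA R k) :=
  homLift (fun r => uD R k r)
    (fun r s => by
      rw [Subgroup.coe_mul, uD_der, gel_mem r.2, one_smul])
    uD_conj

lemma iotaR_cls (r : R) : iotaR R k (cls R k r) = uD R k r := homLift_cls _ _ _ _

/-- The retraction. -/
def rhoR (R : Subgroup (FreeGroup (Fin n))) [R.Normal] (k : Type) [Field k]
    [Fintype (FreeGroup (Fin n) ⧸ R)] : (Fin n → GA R k) →ₗ[GA R k] (conjRep R k).asModule :=
  fromFree (fun i => avg R k (FreeGroup.of i))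

lemma rho_iota [CharZero k] [Fintype (FreeGroup (Fin n) ⧸ R)] (v : (conjRep R k).asModule) :
    rhoR R k (iotaR R k v) = v := by
  have : rhoR R k ∘ₗ iotaR R k = LinearMap.id := by
    apply hom_ext_cls
    intro r
    rw [LinearMap.comp_apply, iotaR_cls, rhoR, fromFree_uD avg_isDer, avg_mem]; rfl
  exact LinearMap.congr_fun this v

/-- The boundary map. -/
def phiR (R : Subgroup (FreeGroup (Fin n))) [R.Normal] (k : Type) [Field k] :
    (Fin n → GA R k) →ₗ[GA R k] GA R k :=
  fromFree (fun i => gel R k (FreeGroup.of i) - 1)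

lemma phi_uD (a : FreeGroup (Fin n)) : phiR R k (uD R k a) = gel R k a - 1 := by
  apply fromFree_uD (d := fun a => gel R k a - 1)
  intro a b
  simp [gel_mul, mul_sub]

lemma phi_iota (v : (conjRep R k).asModule) : phiR R k (iotaR R k v) = 0 := by
  have : phiR R k ∘ₗ iotaR R k = 0 := by
    apply hom_ext_cls
    intro r
    rw [LinearMap.comp_apply, iotaR_cls, phi_uD, gel_mem r.2]; simp
  exact LinearMap.congr_fun this v

/-- The `k`-linear contraction `q ↦ D (s q)`. -/
def conT (R : Subgroup (FreeGroup (Fin n))) [R.Normal] (k : Type) [Field k] :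
    GA R k →ₗ[k] (Fin n → GA R k) :=
  (MonoidAlgebra.basis (FreeGroup (Fin n) ⧸ R) k).constr ℕ (fun q => uD R k (sec R q))

lemma conT_gel (a : FreeGroup (Fin n)) :
    conT R k (gel R k a) = uD R k (sec R (a : FreeGroup (Fin n) ⧸ R)) := by
  have := (MonoidAlgebra.basis (FreeGroup (Fin n) ⧸ R) k).constr_basis ℕ
    (fun q => uD R k (sec R q)) (a : FreeGroup (Fin n) ⧸ R)
  simpa [conT, gel] using this

lemma GA_induction {p : GA R k → Prop} (h0 : p 0) (ha : ∀ x y, p x → p y → p (x + y))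
    (hs : ∀ (c : k) a, p (c • gel R k a)) (x : GA R k) : p x := by
  induction x using MonoidAlgebra.induction_linear with
  | zero => exact h0
  | add x y hx hy => exact ha x y hx hy
  | single q c =>
    obtain ⟨a, rfl⟩ := QuotientGroup.mk_surjective q
    have := hs c a
    simpa [gel, MonoidAlgebra.smul_single] using this

lemma conT_phi (x : Fin n → GA R k) : x - conT R k (phiR R k x) ∈ LinearMap.range (iotaR R k) := by
  have hx : x = ∑ i, x i • (Pi.single i 1 : Fin n → GA R k) := by
    ext j : 1
    simp [Finset.sum_apply, Pi.single_apply]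
  rw [hx, map_sum, map_sum, ← Finset.sum_sub_distrib]
  refine Submodule.sum_mem _ (fun i _ => ?_)
  generalize x i = y
  induction y using GA_induction with
  | h0 => simp
  | ha y z hy hz =>
    have := Submodule.add_mem _ hy hz
    simp only [add_smul, map_add]
    convert this using 1
    abel
  | hs c a =>
    rw [smul_assoc, LinearMap.map_smul_of_tower, map_smul, ← smul_sub]
    refine Submodule.smul_of_tower_mem _ c ?_
    have hs1 : gel R k (sec R (a : FreeGroup (Fin n) ⧸ R)) = gel R k a := by
      rw [gel, gel, sec_mk]
    have h1 : phiR R k (gel R k a • Pi.single i 1) = gel R k (a * FreeGroup.of i) - gel R k a := by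
      rw [map_smul, phiR, fromFree_single, gel_mul, smul_eq_mul, mul_sub, mul_one]
    rw [h1, map_sub, conT_gel, conT_gel]
    let s := sec R (a : FreeGroup (Fin n) ⧸ R)
    let t := sec R ((a * FreeGroup.of i : FreeGroup (Fin n)) : FreeGroup (Fin n) ⧸ R)
    have hr : s * FreeGroup.of i * t⁻¹ ∈ R := by
      rw [← QuotientGroup.eq_one_iff]
      simp [s, t, sec_mk]
    refine ⟨cls R k ⟨_, hr⟩, ?_⟩
    rw [iotaR_cls]
    have h2 : uD R k (s * FreeGroup.of i) = uD R k ((s * FreeGroup.of i * t⁻¹) * t) := by simp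
    rw [uD_der, uD_der _ t, gel_mem hr, one_smul, hs1] at h2
    have h3 : uD R k (FreeGroup.of i) = Pi.single i 1 := fox_of _ _
    rw [h3] at h2
    change uD R k (s * FreeGroup.of i * t⁻¹) = gel R k a • Pi.single i 1 - (uD R k t - uD R k s)
    rw [eq_sub_of_add_eq h2.symm]
    abel

/-- The augmentation. -/
def augR (R : Subgroup (FreeGroup (Fin n))) [R.Normal] (k : Type) [Field k] :
    GA R k →ₗ[GA R k]
      (Representation.trivial k (G := FreeGroup (Fin n) ⧸ R) (V := k)).asModule :=
  LinearMap.toSpanSingleton (GA R k) _ ((Representation.asModuleEquiv _).symm (1 : k))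

lemma augR_smul_gel (c : k) (a : FreeGroup (Fin n)) :
    augR R k (c • gel R k a) = (Representation.asModuleEquiv _).symm c := by
  rw [augR, LinearMap.toSpanSingleton_apply, smul_assoc, gel,
    ← Representation.asModuleEquiv_symm_map_rho]
  rw [← map_smul]
  simp

lemma augR_surj : Function.Surjective (augR R k) := by
  intro x
  obtain ⟨c, rfl⟩ := (Representation.asModuleEquiv _).symm.surjective x
  exact ⟨_, augR_smul_gel c 1⟩

lemma range_phi : LinearMap.range (phiR R k) = LinearMap.ker (augR R k) := by
  apply le_antisymm
  · rw [LinearMap.range_le_ker_iff]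
    refine (Pi.basisFun (GA R k) (Fin n)).ext (fun i => ?_)
    rw [Pi.basisFun_apply, LinearMap.comp_apply, phiR, fromFree_single, map_sub]
    have h1 := augR_smul_gel (R := R) (1 : k) (FreeGroup.of i)
    have h2 := augR_smul_gel (R := R) (1 : k) 1
    rw [gel_one, one_smul] at h2
    rw [one_smul] at h1
    rw [h1, h2, sub_self]; rfl
  · intro x hx
    have key : ∀ x : GA R k, x - algebraMap k (GA R k) ((Representation.asModuleEquiv _) (augR R k x))
        ∈ LinearMap.range (phiR R k) := by
      intro x
      induction x using GA_induction with
      | h0 => simp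
      | ha y z hy hz =>
        have := Submodule.add_mem _ hy hz
        simp only [map_add]
        convert this using 1
        abel
      | hs c a =>
        rw [augR_smul_gel, LinearEquiv.apply_symm_apply, Algebra.algebraMap_eq_smul_one, ← smul_sub]
        exact Submodule.smul_of_tower_mem _ c ⟨uD R k a, phi_uD a⟩
    have := key x
    rw [LinearMap.mem_ker.1 hx] at this
    simpa using this

lemma free_equiv [CharZero k] [Fintype (FreeGroup (Fin n) ⧸ R)] :
    Nonempty ((Fin n → GA R k) ≃ₗ[GA R k]
      ((conjRep R k).asModule × LinearMap.range (phiR R k))) := by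
  refine ⟨LinearEquiv.ofBijective ((rhoR R k).prod (phiR R k).rangeRestrict) ⟨?_, ?_⟩⟩
  · rw [← LinearMap.ker_eq_bot, LinearMap.ker_eq_bot']
    intro x hx
    have h1 : rhoR R k x = 0 := congrArg Prod.fst hx
    have h2 : phiR R k x = 0 := congrArg (fun y => (Prod.snd y).1) hx
    have h3 := conT_phi x
    rw [h2, map_zero, sub_zero] at h3
    obtain ⟨v, rfl⟩ := h3
    rw [rho_iota] at h1
    rw [h1, map_zero]
  · rintro ⟨v, ⟨_, ⟨y, rfl⟩⟩⟩
    refine ⟨y + iotaR R k (v - rhoR R k y), ?_⟩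
    refine Prod.ext ?_ (Subtype.ext ?_)
    · simp [rho_iota]
    · simp [phi_iota]

end

/-- Gaschütz's lemma (Lemma 10a): for a finite-index normal subgroup R of the free group
F_n and a field k of characteristic 0, H₁(R;k) with the conjugation action of G = F_n ⧸ R
is isomorphic as a k[G]-module to k ⊕ k[G]^{n-1}, with k the trivial module. -/
theorem cover_homology_module_free (n : ℕ) (hn : 1 ≤ n)
    (R : Subgroup (FreeGroup (Fin n))) [R.Normal] (hfi : R.FiniteIndex)
    (k : Type) [Field k] [CharZero k] :
    Nonempty ((conjRep R k).asModule ≃ₗ[MonoidAlgebra k (FreeGroup (Fin n) ⧸ R)]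
      ((Representation.trivial k (G := FreeGroup (Fin n) ⧸ R) (V := k)).asModule ×
        (Fin (n - 1) → MonoidAlgebra k (FreeGroup (Fin n) ⧸ R)))) := by
  have : Fintype (FreeGroup (Fin n) ⧸ R) := Fintype.ofFinite _
  have : NeZero (Nat.card (FreeGroup (Fin n) ⧸ R) : k) :=
    ⟨Nat.cast_ne_zero.2 Nat.card_pos.ne'⟩
  have : IsSemisimpleRing (GA R k) := inferInstance
  obtain ⟨e1⟩ := free_equiv (R := R) (k := k)
  obtain ⟨e2⟩ := split_surj (augR R k) augR_surj
  rw [range_phi] at e1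
  obtain ⟨m, rfl⟩ : ∃ m, n = m + 1 := ⟨n - 1, by omega⟩
  let A := GA R k
  let V := (conjRep R k).asModule
  let T := (Representation.trivial k (G := FreeGroup (Fin (m + 1)) ⧸ R) (V := k)).asModule
  let I := LinearMap.ker (augR R k)
  have e3 : A ≃ₗ[A] (I × T) := e2
  have e4 : (Fin (m + 1) → A) ≃ₗ[A] (V × I) := e1
  have e5 : (A × (Fin m → A)) ≃ₗ[A] (Fin (m + 1) → A) :=
    Fin.consLinearEquiv A (fun _ : Fin (m + 1) => A)
  have e6 : (A × V) ≃ₗ[A] ((Fin (m + 1) → A) × T) :=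
    (LinearEquiv.prodComm A A V).trans <|
    ((LinearEquiv.refl A V).prodCongr e3).trans <|
    (LinearEquiv.prodAssoc A V I T).symm.trans <|
    e4.symm.prodCongr (LinearEquiv.refl A T)
  have e7 : (A × V) ≃ₗ[A] (A × (T × (Fin m → A))) :=
    e6.trans <| (e5.symm.prodCongr (LinearEquiv.refl A T)).trans <|
    (LinearEquiv.prodAssoc A A (Fin m → A) T).trans <|
    (LinearEquiv.refl A A).prodCongr (LinearEquiv.prodComm A (Fin m → A) T)
  exact cancel_self V (T × (Fin m → A)) e7
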